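/- Let (ℍ³, b) be hyperbolic space realized as the hyperboloid {t = √(1+|x|²)} in Minkowski space, with second fundamental form k = b, and for a ∈ ℝ³ let v_a(x) = −√(1+|x|²) + ⟨a,x⟩ be the restriction of the function ℓ = −t + ⟨a,x⟩ to this hyperboloid. If |a| = 1, then v_a satisfies the spacetime harmonic equation Δ_b v_a + 3|∇_b v_a| = 0. -/

import Mathlib

open scoped InnerProductSpace

noncomputable section

/-- The function `v_a(x) = −√(1+|x|²) + ⟨a,x⟩`, the restriction of the Minkowski-null
linear function `ℓ = −t + ⟨a,x⟩` to the unit hyperboloid `t = √(1+|x|²)`. -/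
def va (a x : EuclideanSpace ℝ (Fin 3)) : ℝ :=
  -Real.sqrt (1 + ‖x‖ ^ 2) + ⟪a, x⟫_ℝ

/-- The inverse hyperbolic metric `b^{ij} = δ_{ij} + x_i x_j` in the coordinates in
which `b = dr²/(1+r²) + r²σ` on `ℝ³`. -/
def bInv (x : EuclideanSpace ℝ (Fin 3)) (i j : Fin 3) : ℝ :=
  (if i = j then 1 else 0) + x i * x j

/-- Partial derivative `∂_j f` of a function on `ℝ³`. -/
def pd (f : EuclideanSpace ℝ (Fin 3) → ℝ) (x : EuclideanSpace ℝ (Fin 3)) (j : Fin 3) : ℝ :=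
  fderiv ℝ f x (EuclideanSpace.single j 1)

/-- Components `b^{ij}∂_j f` of the hyperbolic gradient of `f`. -/
def hypGradComp (f : EuclideanSpace ℝ (Fin 3) → ℝ)
    (y : EuclideanSpace ℝ (Fin 3)) (i : Fin 3) : ℝ :=
  ∑ j, bInv y i j * pd f y j

/-- The hyperbolic Laplace–Beltrami operator
`Δ_b f = (1/√det b) ∂_i (√det b · b^{ij} ∂_j f)`, with `√det b = (1+|x|²)^{-1/2}`. -/
def hypLap (f : EuclideanSpace ℝ (Fin 3) → ℝ) (x : EuclideanSpace ℝ (Fin 3)) : ℝ :=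
  Real.sqrt (1 + ‖x‖ ^ 2) *
    ∑ i, pd (fun y => (Real.sqrt (1 + ‖y‖ ^ 2))⁻¹ * hypGradComp f y i) x i

/-- The hyperbolic gradient norm `|∇_b f| = √(b^{ij} ∂_i f ∂_j f)`. -/
def hypGradNorm (f : EuclideanSpace ℝ (Fin 3) → ℝ) (x : EuclideanSpace ℝ (Fin 3)) : ℝ :=
  Real.sqrt (∑ i, ∑ j, bInv x i j * pd f x i * pd f x j)

lemma one_add_norm_sq_pos {E : Type*} [NormedAddCommGroup E] (x : E) : 0 < 1 + ‖x‖ ^ 2 := by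
  positivity

lemma hasFDerivAt_sqrt_one_add_norm_sq {E : Type*} [NormedAddCommGroup E]
    [InnerProductSpace ℝ E] (x : E) :
    HasFDerivAt (fun y : E => Real.sqrt (1 + ‖y‖ ^ 2))
      ((Real.sqrt (1 + ‖x‖ ^ 2))⁻¹ • innerSL ℝ x) x := by
  have h := ((hasStrictFDerivAt_norm_sq x).hasFDerivAt.const_add 1).sqrt
    (one_add_norm_sq_pos x).ne'
  convert h using 1
  ext v
  simp
  field_simp

lemma hasFDerivAt_inner_left {E : Type*} [NormedAddCommGroup E]
    [InnerProductSpace ℝ E] (a x : E) :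
    HasFDerivAt (fun y : E => ⟪a, y⟫_ℝ) (innerSL ℝ a) x :=
  (innerSL ℝ a).hasFDerivAt

lemma real_inner_eq_sum_mul {ι : Type*} [Fintype ι] (a x : EuclideanSpace ℝ ι) :
    ⟪a, x⟫_ℝ = ∑ j, a j * x j := by
  simp [PiLp.inner_apply, mul_comm]

lemma norm_sq_eq_sum_mul_self {ι : Type*} [Fintype ι] (x : EuclideanSpace ℝ ι) :
    ‖x‖ ^ 2 = ∑ j, x j * x j := by
  rw [EuclideanSpace.real_norm_sq_eq]
  exact Finset.sum_congr rfl fun j _ => sq _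

lemma pd_va (a x : EuclideanSpace ℝ (Fin 3)) (j : Fin 3) :
    pd (va a) x j = a j - x j / Real.sqrt (1 + ‖x‖ ^ 2) := by
  have h : HasFDerivAt (va a) _ x :=
    (hasFDerivAt_sqrt_one_add_norm_sq x).neg.add (hasFDerivAt_inner_left a x)
  rw [pd, h.fderiv]
  simp [EuclideanSpace.inner_single_right]
  ring

lemma hypGradComp_va (a x : EuclideanSpace ℝ (Fin 3)) (i : Fin 3) :
    hypGradComp (va a) x i = a i + x i * va a x := by
  have hs : Real.sqrt (1 + ‖x‖ ^ 2) ≠ 0 := (Real.sqrt_pos.2 (one_add_norm_sq_pos x)).ne'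
  have hsq := Real.sq_sqrt (one_add_norm_sq_pos x).le
  have hp := real_inner_eq_sum_mul a x
  have hr := norm_sq_eq_sum_mul_self x
  have h : hypGradComp (va a) x i =
      a i - x i / Real.sqrt (1 + ‖x‖ ^ 2) +
        x i * (⟪a, x⟫_ℝ - ‖x‖ ^ 2 / Real.sqrt (1 + ‖x‖ ^ 2)) := by
    simp only [hypGradComp, pd_va, bInv, add_mul, Finset.sum_add_distrib, ite_mul, one_mul,
      zero_mul, Finset.sum_ite_eq, Finset.mem_univ, if_true]
    congr 1
    generalize Real.sqrt (1 + ‖x‖ ^ 2) = s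
    rw [hp, hr, Finset.sum_div, ← Finset.sum_sub_distrib, Finset.mul_sum]
    exact Finset.sum_congr rfl fun j _ => by ring
  rw [h, va]
  field_simp
  linear_combination x i * hsq

lemma hypLap_va (a x : EuclideanSpace ℝ (Fin 3)) : hypLap (va a) x = 3 * va a x := by
  have hs : Real.sqrt (1 + ‖x‖ ^ 2) ≠ 0 := (Real.sqrt_pos.2 (one_add_norm_sq_pos x)).ne'
  have hsq := Real.sq_sqrt (one_add_norm_sq_pos x).le
  have hp := real_inner_eq_sum_mul a x
  have hr := norm_sq_eq_sum_mul_self x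
  have hd (i : Fin 3) :
      pd (fun y => (Real.sqrt (1 + ‖y‖ ^ 2))⁻¹ * hypGradComp (va a) y i) x i =
        -(x i / Real.sqrt (1 + ‖x‖ ^ 2) ^ 3) * (a i + x i * va a x) +
          (Real.sqrt (1 + ‖x‖ ^ 2))⁻¹ *
            (va a x + x i * (a i - x i / Real.sqrt (1 + ‖x‖ ^ 2))) := by
    simp only [hypGradComp_va]
    have hv : HasFDerivAt (va a) _ x :=
      (hasFDerivAt_sqrt_one_add_norm_sq x).neg.add (hasFDerivAt_inner_left a x)
    have hx : HasFDerivAt (fun y : EuclideanSpace ℝ (Fin 3) => y i)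
        (EuclideanSpace.proj i : EuclideanSpace ℝ (Fin 3) →L[ℝ] ℝ) x :=
      (EuclideanSpace.proj i : EuclideanSpace ℝ (Fin 3) →L[ℝ] ℝ).hasFDerivAt
    have h := ((hasDerivAt_inv hs).comp_hasFDerivAt x (hasFDerivAt_sqrt_one_add_norm_sq x)).mul
      ((hx.mul hv).const_add (a i))
    rw [pd]
    refine (congrArg (· (EuclideanSpace.single i 1)) h.fderiv).trans ?_
    simp [EuclideanSpace.inner_single_right]
    field_simp
    ring
  rw [hypLap, Finset.sum_congr rfl fun i _ => hd i]
  have hv : va a x = -Real.sqrt (1 + ‖x‖ ^ 2) + ⟪a, x⟫_ℝ := rfl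
  have hr' : ‖x‖ ^ 2 = Real.sqrt (1 + ‖x‖ ^ 2) ^ 2 - 1 := by linarith
  generalize va a x = v at *
  generalize Real.sqrt (1 + ‖x‖ ^ 2) = s at *
  have hsum : ∑ i, (-(x i / s ^ 3) * (a i + x i * v) + s⁻¹ * (v + x i * (a i - x i / s))) =
      -(⟪a, x⟫_ℝ + ‖x‖ ^ 2 * v) / s ^ 3 + s⁻¹ * (3 * v + ⟪a, x⟫_ℝ - ‖x‖ ^ 2 / s) := by
    rw [hp, hr]
    simp only [Fin.sum_univ_three]
    ring
  rw [hsum, hr', hv]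
  field_simp
  ring

lemma hypGradNorm_va (a : EuclideanSpace ℝ (Fin 3)) (ha : ‖a‖ = 1)
    (x : EuclideanSpace ℝ (Fin 3)) : hypGradNorm (va a) x = -va a x := by
  have hs : 0 < Real.sqrt (1 + ‖x‖ ^ 2) := Real.sqrt_pos.2 (one_add_norm_sq_pos x)
  have hsq := Real.sq_sqrt (one_add_norm_sq_pos x).le
  have hp := real_inner_eq_sum_mul a x
  have hr := norm_sq_eq_sum_mul_self x
  have hna := norm_sq_eq_sum_mul_self a
  have hle : va a x ≤ 0 := by
    have h1 := real_inner_le_norm a x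
    have h2 : ‖x‖ ≤ Real.sqrt (1 + ‖x‖ ^ 2) := Real.le_sqrt_of_sq_le (by linarith)
    rw [ha, one_mul] at h1
    rw [va]
    linarith
  have hsum : ∑ i, ∑ j, bInv x i j * pd (va a) x i * pd (va a) x j = (-va a x) ^ 2 := by
    have h (i : Fin 3) : ∑ j, bInv x i j * pd (va a) x i * pd (va a) x j =
        (a i - x i / Real.sqrt (1 + ‖x‖ ^ 2)) * (a i + x i * va a x) := by
      rw [← hypGradComp_va, hypGradComp, ← pd_va, Finset.mul_sum]
      exact Finset.sum_congr rfl fun j _ => by ring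
    rw [Finset.sum_congr rfl fun i _ => h i]
    have hv : va a x = -Real.sqrt (1 + ‖x‖ ^ 2) + ⟪a, x⟫_ℝ := rfl
    have hr' : ‖x‖ ^ 2 = Real.sqrt (1 + ‖x‖ ^ 2) ^ 2 - 1 := by linarith
    clear h hle
    generalize va a x = v at *
    generalize Real.sqrt (1 + ‖x‖ ^ 2) = s at *
    have hsum : ∑ i, (a i - x i / s) * (a i + x i * v) =
        ‖a‖ ^ 2 + ⟪a, x⟫_ℝ * v - (⟪a, x⟫_ℝ + ‖x‖ ^ 2 * v) / s := by
      rw [hp, hr, hna]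
      simp only [Fin.sum_univ_three]
      ring
    rw [hsum, hr', ha, hv]
    field_simp
    ring
  rw [hypGradNorm, hsum, Real.sqrt_sq (neg_nonneg.2 hle)]

/-- For a unit vector `a ∈ ℝ³`, the function
`v_a(x) = −√(1+|x|²) + ⟨a,x⟩` on hyperbolic space `(ℍ³, b)` (realized as the
hyperboloid, which is totally umbilic with `k = b`, so `tr_b k = 3`) satisfies the
spacetime harmonic equation `Δ_b v_a + 3|∇_b v_a| = 0`. -/
theorem va_spacetime_harmonic (a : EuclideanSpace ℝ (Fin 3)) (ha : ‖a‖ = 1)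
    (x : EuclideanSpace ℝ (Fin 3)) :
    hypLap (va a) x + 3 * hypGradNorm (va a) x = 0 := by
  rw [hypLap_va, hypGradNorm_va a ha]
  ring

end
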